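/- Let Ψ be a nonempty countable collection of measurable functions on a measurable space Y with α ≤ ψ ≤ β for all ψ ∈ Ψ. Let 0 ≤ a < 1 < b ≤ ∞ and f ∈ F₁(a,b) be strictly convex in a neighborhood of 1 with z₀ + β − α in the interior of {f* < ∞}, where z₀ := f'_+(1). Let P be a probability measure on Y, let Y₁,…,Y_n be i.i.d. samples from P, and let P_n be the corresponding empirical measure. Then, for either choice of sign, E[ sup_{ψ∈Ψ} { ±( Λ_f^P[ψ] − Λ_f^{P_n}[ψ] ) } ] ≤ 2 (f*)'_+(β−α+z₀) ( R_{Ψ,P,n} + (β−α)/(2 n^{1/2}) ). -/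

import Mathlib

open MeasureTheory Set Filter Topology
open scoped ENNReal NNReal Classical

noncomputable section

/-- The interval `(a, b)` with `b` possibly infinite. -/
def Dom (a : ℝ) (b : EReal) : Set ℝ := {t : ℝ | a < t ∧ (t : EReal) < b}

/-- Legendre transform of `f` on `(a,b)`, with values in `(-∞, ∞]` (modeled by `EReal`). -/
def fStar (f : ℝ → ℝ) (a : ℝ) (b : EReal) (z : ℝ) : EReal :=
  ⨆ t ∈ Dom a b, ((z * t - f t : ℝ) : EReal)

/-- Real-valued version of the Legendre transform (junk value where it is `⊤`). -/
def fStarR (f : ℝ → ℝ) (a : ℝ) (b : EReal) (z : ℝ) : ℝ := (fStar f a b z).toReal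

/-- Right derivative of `g` at `z`. -/
def rderiv (g : ℝ → ℝ) (z : ℝ) : ℝ := derivWithin g (Ici z) z

/-- `z₀ := f'_+(1)`. -/
def zz (f : ℝ → ℝ) : ℝ := rderiv f 1

/-- Integral of an `EReal`-valued function: the Bochner integral if the function is
a.e. finite and integrable, and `⊤` otherwise. -/
def eIntegral {X : Type*} [MeasurableSpace X] (P : Measure X) (g : X → EReal) : EReal :=
  if (∀ᵐ x ∂P, g x ≠ ⊤) ∧ Integrable (fun x => (g x).toReal) P
  then ((∫ x, (g x).toReal ∂P : ℝ) : EReal) else ⊤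

/-- The generalized cumulant generating function `Λ_f^P[h]`. -/
def cgf {X : Type*} [MeasurableSpace X] (f : ℝ → ℝ) (a : ℝ) (b : EReal)
    (P : Measure X) (h : X → ℝ) : EReal :=
  ⨅ ν : ℝ, ((ν : EReal) + eIntegral P (fun x => fStar f a b (h x - ν)))

/-- Real-valued `Λ_f^P[h]`. -/
def cgfR {X : Type*} [MeasurableSpace X] (f : ℝ → ℝ) (a : ℝ) (b : EReal)
    (P : Measure X) (h : X → ℝ) : ℝ := (cgf f a b P h).toReal

/-- `Λ_f : ℝⁿ → ℝ` (with values in `EReal`). -/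
def lamVec (f : ℝ → ℝ) (a : ℝ) (b : EReal) {n : ℕ} (x : Fin n → ℝ) : EReal :=
  ⨅ ν : ℝ, ((ν : EReal) + ((n : ℝ)⁻¹ : EReal) * ∑ i, fStar f a b (x i - ν))

/-- Empirical measure of `n` points. -/
def empMeas {X : Type*} [MeasurableSpace X] (n : ℕ) (xs : Fin n → X) : Measure X :=
  (n : ℝ≥0∞)⁻¹ • ∑ i, Measure.dirac (xs i)

/-- The `(f,Γ)`-divergence `D_f^Γ(Q‖P)`. -/
def Dfg {X : Type*} [MeasurableSpace X] (f : ℝ → ℝ) (a : ℝ) (b : EReal)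
    (Γ : Set (X → ℝ)) (Q P : Measure X) : ℝ :=
  sSup {r : ℝ | ∃ h ∈ Γ, r = ∫ x, h x ∂Q - cgfR f a b P h}

/-- Empirical Rademacher complexity of `Ψ` at the sample `y`. -/
def empRad {Y : Type*} (Ψ : Set (Y → ℝ)) (n : ℕ) (y : Fin n → Y) : ℝ :=
  (2 ^ n : ℝ)⁻¹ * ∑ σ : Fin n → Bool,
    sSup {r : ℝ | ∃ ψ ∈ Ψ, r = (n : ℝ)⁻¹ * ∑ i, (if σ i then 1 else -1) * ψ (y i)}

/-- Rademacher complexity of `Ψ` relative to `P` with `n` samples. -/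
def rad {Y : Type*} [MeasurableSpace Y] (Ψ : Set (Y → ℝ)) (P : Measure Y) (n : ℕ) : ℝ :=
  ∫ y, empRad Ψ n y ∂(Measure.pi fun _ : Fin n => P)

/-- `Δ_{f,n}`. -/
def Δq (f : ℝ → ℝ) (a : ℝ) (b : EReal) (α β : ℝ) (n : ℕ) : ℝ :=
  sInf ((fun z => (n : ℝ) * (-z + (((n : ℝ) - 1) / (n : ℝ)) * fStarR f a b z
      + (1 / (n : ℝ)) * fStarR f a b (β - α + z))) '' Icc (zz f - (β - α)) (zz f))

/-- `sup_{h ∈ Γ} inf_{h̃ ∈ Γ̃} ‖h − h̃‖_∞`. -/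
def approxErr {X : Type*} (Γ Γt : Set (X → ℝ)) : ℝ :=
  sSup {r : ℝ | ∃ h ∈ Γ, r = sInf {s : ℝ | ∃ ht ∈ Γt, s = ⨆ x, |h x - ht x|}}

/-- A countable subset which is pointwise-limit dense. -/
def PtwiseDenseCount {X : Type*} (Γ : Set (X → ℝ)) : Prop :=
  ∃ Γ₀ ⊆ Γ, Γ₀.Countable ∧ ∀ h ∈ Γ, ∃ s : ℕ → X → ℝ,
    (∀ j, s j ∈ Γ₀) ∧ ∀ x, Tendsto (fun j => s j x) atTop (𝓝 (h x))

/-- The quantity `K_{f,Ψ,P,n}` from Definition 3.4: either `(f*)'_+` is Lipschitz on the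
relevant interval and `Ψ` contains a constant, in which case `K` is the minimum of the two
expressions, or `K` is the second expression. -/
def Kchoice (f : ℝ → ℝ) (a : ℝ) (b : EReal) (α β : ℝ) {Y : Type*} [MeasurableSpace Y]
    (Ψ : Set (Y → ℝ)) (P : Measure Y) (n : ℕ) (K : ℝ) : Prop :=
  (∃ L : ℝ≥0, LipschitzOnWith L (rderiv (fStarR f a b))
      (Icc (zz f - (β - α)) (zz f + (β - α))) ∧
    (∃ c : ℝ, (fun _ => c) ∈ Ψ) ∧
    K = min ((1 + 2 * (β - α) * (L : ℝ)) * rad Ψ P n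
        + (β - α) ^ 2 * (L : ℝ) / (2 * Real.sqrt n))
      (rderiv (fStarR f a b) (β - α + zz f) * (rad Ψ P n + (β - α) / (2 * Real.sqrt n))))
  ∨ K = rderiv (fStarR f a b) (β - α + zz f) * (rad Ψ P n + (β - α) / (2 * Real.sqrt n))

/-- Covering number of a (pseudo)metric space by `ε`-balls. -/
def coverNum (Θ : Type*) [PseudoMetricSpace Θ] (ε : ℝ) : ℝ≥0∞ :=
  ⨅ s ∈ {s : Finset Θ | ∀ θ : Θ, ∃ c ∈ s, dist θ c ≤ ε}, ((s.card : ℝ≥0∞))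

end

section Legendre

variable {f : ℝ → ℝ} {a : ℝ} {b : EReal}

theorem one_mem_Dom (ha1 : a < 1) (hb1 : ((1 : ℝ) : EReal) < b) : (1 : ℝ) ∈ Dom a b := ⟨ha1, hb1⟩

theorem isOpen_Dom (a : ℝ) (b : EReal) : IsOpen (Dom a b) :=
  (isOpen_lt continuous_const continuous_id).inter
    (isOpen_lt continuous_coe_real_ereal continuous_const)

theorem sub_le_fStar {t : ℝ} (ht : t ∈ Dom a b) (z : ℝ) :
    ((z * t - f t : ℝ) : EReal) ≤ fStar f a b z :=
  le_iSup₂ (f := fun t (_ : t ∈ Dom a b) => ((z * t - f t : ℝ) : EReal)) t ht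

theorem fStar_mono (ha0 : 0 ≤ a) : Monotone (fStar f a b) := by
  intro w z hwz
  refine iSup₂_le fun t ht => le_trans ?_ (sub_le_fStar ht z)
  have h0 : 0 ≤ t := ha0.trans ht.1.le
  exact_mod_cast sub_le_sub_right (mul_le_mul_of_nonneg_right hwz h0) _

theorem le_fStar (h1 : (1 : ℝ) ∈ Dom a b) (hf1 : f 1 = 0) (z : ℝ) :
    (z : EReal) ≤ fStar f a b z := by
  simpa [hf1] using sub_le_fStar (f := f) h1 z

theorem coe_fStarR (h1 : (1 : ℝ) ∈ Dom a b) (hf1 : f 1 = 0) {z : ℝ}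
    (hz : fStar f a b z < ⊤) : ((fStarR f a b z : ℝ) : EReal) = fStar f a b z :=
  EReal.coe_toReal hz.ne ((EReal.bot_lt_coe z).trans_le (le_fStar h1 hf1 z)).ne'

theorem le_fStarR (h1 : (1 : ℝ) ∈ Dom a b) (hf1 : f 1 = 0) {z : ℝ}
    (hz : fStar f a b z < ⊤) : z ≤ fStarR f a b z := by
  have h := le_fStar h1 hf1 z
  rw [← coe_fStarR h1 hf1 hz] at h
  exact_mod_cast h

theorem convexOn_fStarR (ha0 : 0 ≤ a) (h1 : (1 : ℝ) ∈ Dom a b) (hf1 : f 1 = 0) :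
    ConvexOn ℝ {z : ℝ | fStar f a b z < ⊤} (fStarR f a b) := by
  have hJ : Convex ℝ {z : ℝ | fStar f a b z < ⊤} := by
    apply Set.OrdConnected.convex
    exact ⟨fun x _ y hy z hz => (fStar_mono ha0 hz.2).trans_lt hy⟩
  refine ⟨hJ, fun x hx y hy p q hp hq hpq => ?_⟩
  have hxy := hJ hx hy hp hq hpq
  have key : fStar f a b (p • x + q • y) ≤
      ((p • fStarR f a b x + q • fStarR f a b y : ℝ) : EReal) := by
    refine iSup₂_le fun t ht => ?_
    have e1 := sub_le_fStar (f := f) ht x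
    have e2 := sub_le_fStar (f := f) ht y
    rw [← coe_fStarR h1 hf1 hx] at e1
    rw [← coe_fStarR h1 hf1 hy] at e2
    norm_cast at e1 e2 ⊢
    simp only [smul_eq_mul]
    obtain rfl : q = 1 - p := by linarith
    nlinarith [mul_le_mul_of_nonneg_left e1 hp, mul_le_mul_of_nonneg_left e2 hq]
  rw [← coe_fStarR h1 hf1 hxy] at key
  exact_mod_cast key

theorem fStar_zz (h1 : (1 : ℝ) ∈ Dom a b) (hf1 : f 1 = 0) (hconv : ConvexOn ℝ (Dom a b) f) :
    fStar f a b (zz f) = zz f := by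
  refine le_antisymm (iSup₂_le fun t ht => ?_) (le_fStar h1 hf1 _)
  have hint : (1 : ℝ) ∈ interior (Dom a b) := by rwa [(isOpen_Dom a b).interior_eq]
  have hz : zz f = derivWithin f (Ioi 1) 1 := (derivWithin_Ioi_eq_Ici f 1).symm
  rw [hz]
  norm_cast
  rcases lt_trichotomy t 1 with h | h | h
  · have h2 := (hconv.slope_le_leftDeriv_of_mem_interior ht hint h).trans
      (hconv.leftDeriv_le_rightDeriv_of_mem_interior hint)
    rw [slope_def_field, hf1, div_le_iff₀ (by linarith)] at h2
    linarith
  · subst h; simp [hf1]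
  · have h2 := hconv.rightDeriv_le_slope_of_mem_interior hint ht h
    rw [slope_def_field, hf1, le_div_iff₀ (by linarith)] at h2
    linarith

theorem fStarR_zz (h1 : (1 : ℝ) ∈ Dom a b) (hf1 : f 1 = 0) (hconv : ConvexOn ℝ (Dom a b) f) :
    fStarR f a b (zz f) = zz f := by
  rw [fStarR, fStar_zz h1 hf1 hconv, EReal.toReal_coe]

theorem sub_le_fStarR_sub (ha0 : 0 ≤ a) (h1 : (1 : ℝ) ∈ Dom a b) (hf1 : f 1 = 0)
    (hconv : ConvexOn ℝ (Dom a b) f) {w z : ℝ} (hw : zz f ≤ w) (hwz : w ≤ z)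
    (hz : fStar f a b z < ⊤) : z - w ≤ fStarR f a b z - fStarR f a b w := by
  rcases hwz.eq_or_lt with rfl | hlt
  · simp
  have hz0 : fStar f a b (zz f) < ⊤ := by simp [fStar_zz h1 hf1 hconv]
  have hd : 0 < z - zz f := by linarith
  have h := (convexOn_fStarR (f := f) ha0 h1 hf1).2 hz0 hz
    (div_nonneg (sub_nonneg.2 hwz) hd.le) (div_nonneg (sub_nonneg.2 hw) hd.le)
    (by field_simp; ring)
  have e : ((z - w) / (z - zz f)) • zz f + ((w - zz f) / (z - zz f)) • z = w := by
    simp only [smul_eq_mul]; field_simp; ring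
  rw [e, fStarR_zz h1 hf1 hconv] at h
  simp only [smul_eq_mul] at h
  have h3 := le_fStarR h1 hf1 hz
  have h4 : (z - w) / (z - zz f) * (fStarR f a b z - z) ≥ 0 :=
    mul_nonneg (div_nonneg (sub_nonneg.2 hwz) hd.le) (by linarith)
  have e2 : (w - zz f) / (z - zz f) = 1 - (z - w) / (z - zz f) := by field_simp; ring
  have e3 : (z - w) / (z - zz f) * (z - zz f) = z - w := by field_simp
  rw [e2] at h
  nlinarith

theorem fStarR_sub_le_sub (ha0 : 0 ≤ a) (h1 : (1 : ℝ) ∈ Dom a b) (hf1 : f 1 = 0)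
    (hconv : ConvexOn ℝ (Dom a b) f) {w z : ℝ} (hwz : w ≤ z) (hz : z ≤ zz f) :
    fStarR f a b z - fStarR f a b w ≤ z - w := by
  rcases hwz.eq_or_lt with rfl | hlt
  · simp
  have hz0 : fStar f a b (zz f) < ⊤ := by simp [fStar_zz h1 hf1 hconv]
  have hw : fStar f a b w < ⊤ := (fStar_mono ha0 (hwz.trans hz)).trans_lt hz0
  have hd : 0 < zz f - w := by linarith
  have h := (convexOn_fStarR (f := f) ha0 h1 hf1).2 hz0 hw
    (div_nonneg (sub_nonneg.2 hwz) hd.le) (div_nonneg (sub_nonneg.2 hz) hd.le)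
    (by field_simp; ring)
  have e : ((z - w) / (zz f - w)) • zz f + ((zz f - z) / (zz f - w)) • w = z := by
    simp only [smul_eq_mul]; field_simp; ring
  rw [e, fStarR_zz h1 hf1 hconv] at h
  simp only [smul_eq_mul] at h
  have h3 := le_fStarR h1 hf1 hw
  have h4 : (z - w) / (zz f - w) * (fStarR f a b w - w) ≥ 0 :=
    mul_nonneg (div_nonneg (sub_nonneg.2 hwz) hd.le) (by linarith)
  have e2 : (zz f - z) / (zz f - w) = 1 - (z - w) / (zz f - w) := by field_simp; ring
  have e3 : (z - w) / (zz f - w) * (zz f - w) = z - w := by field_simp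
  rw [e2] at h
  nlinarith

theorem fStarR_le_fStarR (ha0 : 0 ≤ a) (h1 : (1 : ℝ) ∈ Dom a b) (hf1 : f 1 = 0) {w z : ℝ}
    (hwz : w ≤ z) (hz : fStar f a b z < ⊤) : fStarR f a b w ≤ fStarR f a b z := by
  have h := fStar_mono (f := f) (b := b) ha0 hwz
  have hw := h.trans_lt hz
  rw [← coe_fStarR h1 hf1 hz, ← coe_fStarR h1 hf1 hw] at h
  exact_mod_cast h

theorem abs_fStarR_sub_le (ha0 : 0 ≤ a) (h1 : (1 : ℝ) ∈ Dom a b) (hf1 : f 1 = 0) {z₁ : ℝ}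
    (hz₁ : z₁ ∈ interior {z : ℝ | fStar f a b z < ⊤}) {w z : ℝ} (hw : w ≤ z₁) (hz : z ≤ z₁) :
    |fStarR f a b w - fStarR f a b z| ≤ rderiv (fStarR f a b) z₁ * |w - z| := by
  wlog hwz : w ≤ z generalizing w z
  · rw [abs_sub_comm, abs_sub_comm w]
    exact this hz hw (le_of_not_ge hwz)
  rcases hwz.eq_or_lt with rfl | hlt
  · simp
  have hconv := convexOn_fStarR (f := f) ha0 h1 hf1
  have hfin₁ : z₁ ∈ {z : ℝ | fStar f a b z < ⊤} := interior_subset hz₁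
  have hfin : ∀ {x}, x ≤ z₁ → fStar f a b x < ⊤ := fun hx => (fStar_mono ha0 hx).trans_lt hfin₁
  have hr : rderiv (fStarR f a b) z₁ = derivWithin (fStarR f a b) (Ioi z₁) z₁ :=
    (derivWithin_Ioi_eq_Ici _ _).symm
  have hslope : slope (fStarR f a b) w z ≤ rderiv (fStarR f a b) z₁ := by
    rw [hr]
    have hwz₁ : w < z₁ := hlt.trans_le hz
    refine le_trans ?_ ((hconv.slope_le_leftDeriv_of_mem_interior (hfin hw) hz₁ hwz₁).trans
      (hconv.leftDeriv_le_rightDeriv_of_mem_interior hz₁))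
    exact hconv.slope_mono (hfin hw) ⟨hfin hz, hlt.ne'⟩ ⟨hfin le_rfl, hwz₁.ne'⟩ hz
  rw [slope_def_field, div_le_iff₀ (by linarith)] at hslope
  have hm := fStarR_le_fStarR ha0 h1 hf1 hwz (hfin hz)
  rw [abs_sub_comm, abs_sub_comm w, abs_of_nonneg (by linarith), abs_of_nonneg (by linarith)]
  exact hslope

theorem rderiv_fStarR_nonneg (ha0 : 0 ≤ a) (h1 : (1 : ℝ) ∈ Dom a b) (hf1 : f 1 = 0) {z₁ : ℝ}
    (hz₁ : z₁ ∈ interior {z : ℝ | fStar f a b z < ⊤}) : 0 ≤ rderiv (fStarR f a b) z₁ := by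
  have h := abs_fStarR_sub_le ha0 h1 hf1 hz₁ (show z₁ - 1 ≤ z₁ by linarith) le_rfl
  have := (abs_nonneg _).trans h
  simpa using this

theorem measurable_fStarR (ha0 : 0 ≤ a) : Measurable (fStarR f a b) :=
  (fStar_mono ha0).measurable.ereal_toReal

theorem fStar_sub_lt_top {X : Type*} {α β ν : ℝ} {h : X → ℝ} (ha0 : 0 ≤ a)
    (hz : fStar f a b (β - α + zz f) < ⊤) (hb : ∀ x, h x ∈ Icc α β) (hν : α - zz f ≤ ν) (x : X) :
    fStar f a b (h x - ν) < ⊤ :=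
  (fStar_mono ha0 (by linarith [(hb x).2])).trans_lt hz

theorem abs_fStarR_sub_le_max {X : Type*} {α β ν : ℝ} {h : X → ℝ} (ha0 : 0 ≤ a)
    (h1 : (1 : ℝ) ∈ Dom a b) (hf1 : f 1 = 0) (hz : fStar f a b (β - α + zz f) < ⊤)
    (hb : ∀ x, h x ∈ Icc α β) (hν : α - zz f ≤ ν) (x : X) :
    |fStarR f a b (h x - ν)| ≤ max |fStarR f a b (β - α + zz f)| |α - ν| := by
  have hu := fStarR_le_fStarR ha0 h1 hf1 (show h x - ν ≤ β - α + zz f by linarith [(hb x).2]) hz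
  have hl : α - ν ≤ fStarR f a b (h x - ν) :=
    (sub_le_sub_right (hb x).1 ν).trans (le_fStarR h1 hf1 (fStar_sub_lt_top ha0 hz hb hν x))
  rw [max_comm]
  exact abs_le_max_abs_abs hl hu

end Legendre

/-- The sign `±1` encoded by a Boolean. -/
def boolSign (c : Bool) : ℝ := if c then 1 else -1

theorem boolSign_not (c : Bool) : boolSign (!c) = -boolSign c := by
  cases c <;> simp [boolSign]

theorem abs_boolSign (c : Bool) : |boolSign c| = 1 := by
  cases c <;> simp [boolSign]

section Signs

variable {ι : Type*} {n : ℕ}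

/-- Flipping the `k`-th sign, as a permutation of sign vectors. -/
def flipSign (k : Fin n) : (Fin n → Bool) ≃ (Fin n → Bool) :=
  Function.Involutive.toPerm (fun σ => Function.update σ k (!σ k)) fun σ => by simp

theorem flipSign_apply_self (k : Fin n) (σ : Fin n → Bool) : flipSign k σ k = !σ k := by
  simp [flipSign, Function.Involutive.toPerm]

theorem flipSign_apply_of_ne {k l : Fin n} (h : l ≠ k) (σ : Fin n → Bool) :
    flipSign k σ l = σ l := by
  simp [flipSign, Function.Involutive.toPerm, h]

theorem sum_boolSign_mul_eq_zero (k : Fin n) (g : (Fin n → Bool) → ℝ)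
    (hg : ∀ σ, g (flipSign k σ) = g σ) : ∑ σ : Fin n → Bool, boolSign (σ k) * g σ = 0 := by
  have h := Equiv.sum_comp (flipSign k) fun σ => boolSign (σ k) * g σ
  simp only [flipSign_apply_self, boolSign_not, hg, neg_mul, Finset.sum_neg_distrib] at h
  linarith

theorem sum_sum_boolSign (n : ℕ) : ∑ σ : Fin n → Bool, ∑ k, boolSign (σ k) = 0 := by
  rw [Finset.sum_comm]
  exact Finset.sum_eq_zero fun k _ => by
    simpa using sum_boolSign_mul_eq_zero k (fun _ => 1) fun _ => rfl

theorem sum_sq_sum_boolSign (n : ℕ) :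
    ∑ σ : Fin n → Bool, (∑ k, boolSign (σ k)) ^ 2 = 2 ^ n * n := by
  simp_rw [sq, Finset.sum_mul_sum]
  rw [Finset.sum_comm]
  have h : ∀ k : Fin n, ∑ σ : Fin n → Bool, ∑ l, boolSign (σ k) * boolSign (σ l) = 2 ^ n := by
    intro k
    rw [Finset.sum_comm, Finset.sum_eq_single k]
    · simp [← abs_mul_abs_self (boolSign _), abs_boolSign]
    · intro l _ hl
      exact sum_boolSign_mul_eq_zero k (fun σ => boolSign (σ l)) fun σ => by
        simp only [flipSign_apply_of_ne hl]
    · simp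
  simp [h, mul_comm]

theorem sum_abs_sum_boolSign_le (n : ℕ) :
    ∑ σ : Fin n → Bool, |∑ k, boolSign (σ k)| ≤ 2 ^ n * √n := by
  have h := sq_sum_le_card_mul_sum_sq (s := (Finset.univ : Finset (Fin n → Bool)))
    (f := fun σ => |∑ k, boolSign (σ k)|)
  simp only [sq_abs, sum_sq_sum_boolSign] at h
  have hc : ((Finset.univ : Finset (Fin n → Bool)).card : ℝ) = 2 ^ n := by simp
  rw [hc] at h
  refine abs_le_of_sq_le_sq' ?_ (by positivity) |>.2
  rw [mul_pow, Real.sq_sqrt (by positivity)]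
  linarith

/-- Supremum over a family of vectors of their signed coordinate sums. -/
noncomputable def signSup (x : ι → Fin n → ℝ) (σ : Fin n → Bool) : ℝ :=
  ⨆ i, ∑ k, boolSign (σ k) * x i k

theorem sum_boolSign_mul_le {x : Fin n → ℝ} {C : ℝ} (hx : ∀ k, |x k| ≤ C) (σ : Fin n → Bool) :
    |∑ k, boolSign (σ k) * x k| ≤ n * C := by
  refine (Finset.abs_sum_le_sum_abs _ _).trans ((Finset.sum_le_sum fun k _ => ?_).trans_eq
    (b := ∑ _k : Fin n, C) (by simp))
  rw [abs_mul, abs_boolSign, one_mul]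
  exact hx k

theorem bddAbove_boolSign {x : ι → Fin n → ℝ} {C : ℝ} (hx : ∀ i k, |x i k| ≤ C)
    (σ : Fin n → Bool) : BddAbove (range fun i => ∑ k, boolSign (σ k) * x i k) :=
  ⟨n * C, by rintro _ ⟨i, rfl⟩; exact (le_abs_self _).trans (sum_boolSign_mul_le (hx i) σ)⟩

theorem abs_signSup_le [Nonempty ι] {x : ι → Fin n → ℝ} {C : ℝ} (hx : ∀ i k, |x i k| ≤ C)
    (σ : Fin n → Bool) : |signSup x σ| ≤ n * C := by
  obtain ⟨i⟩ := ‹Nonempty ι›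
  have h := fun i => abs_le.1 (sum_boolSign_mul_le (hx i) σ)
  have : Nonempty ι := ⟨i⟩
  exact abs_le.2 ⟨(h i).1.trans (le_ciSup (bddAbove_boolSign hx σ) i), ciSup_le fun i => (h i).2⟩

theorem iSup_add_iSup_sub_le [Nonempty ι] {u v w : ι → ℝ}
    (hp : BddAbove (range fun i => u i + w i)) (hm : BddAbove (range fun i => u i - w i))
    (h : ∀ i j, |v i - v j| ≤ |w i - w j|) :
    (⨆ i, (u i + v i)) + (⨆ i, (u i - v i)) ≤ (⨆ i, (u i + w i)) + ⨆ i, (u i - w i) := by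
  rw [← le_sub_iff_add_le]
  refine ciSup_le fun i => ?_
  rw [le_sub_iff_add_le, ← le_sub_iff_add_le']
  refine ciSup_le fun j => ?_
  have h0 := (le_abs_self _).trans (h i j)
  have hpi := le_ciSup hp i
  have hpj := le_ciSup hp j
  have hmi := le_ciSup hm i
  have hmj := le_ciSup hm j
  rcases abs_cases (w i - w j) with h1 | h1 <;> linarith

theorem sum_flipSign (x : Fin n → ℝ) (k : Fin n) (σ : Fin n → Bool) :
    ∑ l, boolSign (flipSign k σ l) * x l =
      ∑ l ∈ Finset.univ.erase k, boolSign (σ l) * x l - boolSign (σ k) * x k := by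
  rw [← Finset.sum_erase_add _ _ (Finset.mem_univ k), flipSign_apply_self, boolSign_not,
    neg_mul, ← sub_eq_add_neg]
  congr 1
  exact Finset.sum_congr rfl fun l hl => by rw [flipSign_apply_of_ne (Finset.ne_of_mem_erase hl)]

theorem signSup_flip (x : ι → Fin n → ℝ) (k : Fin n) (σ : Fin n → Bool) :
    signSup x (flipSign k σ) = ⨆ i, (∑ l ∈ Finset.univ.erase k, boolSign (σ l) * x i l
      - boolSign (σ k) * x i k) :=
  iSup_congr fun i => sum_flipSign (x i) k σ

theorem signSup_eq (x : ι → Fin n → ℝ) (k : Fin n) (σ : Fin n → Bool) :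
    signSup x σ = ⨆ i, (∑ l ∈ Finset.univ.erase k, boolSign (σ l) * x i l
      + boolSign (σ k) * x i k) := by
  refine iSup_congr fun i => ?_
  rw [Finset.sum_erase_add _ _ (Finset.mem_univ k)]

theorem sum_signSup_le_of_coord [Nonempty ι] {x y : ι → Fin n → ℝ} {C : ℝ} (k : Fin n)
    (hxy : ∀ i l, l ≠ k → x i l = y i l) (hk : ∀ i j, |x i k - x j k| ≤ |y i k - y j k|)
    (hy : ∀ i l, |y i l| ≤ C) : ∑ σ, signSup x σ ≤ ∑ σ, signSup y σ := by
  have key : ∀ σ, signSup x σ + signSup x (flipSign k σ) ≤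
      signSup y σ + signSup y (flipSign k σ) := by
    intro σ
    have hp := bddAbove_boolSign hy σ
    have hm := bddAbove_boolSign hy (flipSign k σ)
    rw [signSup_flip, signSup_flip, signSup_eq x k, signSup_eq y k]
    have e : ∀ i, ∑ l ∈ Finset.univ.erase k, boolSign (σ l) * x i l =
        ∑ l ∈ Finset.univ.erase k, boolSign (σ l) * y i l := fun i =>
      Finset.sum_congr rfl fun l hl => by rw [hxy i l (Finset.ne_of_mem_erase hl)]
    simp_rw [e]
    refine iSup_add_iSup_sub_le (v := fun i => boolSign (σ k) * x i k)
      (w := fun i => boolSign (σ k) * y i k) ?_ ?_ fun i j => ?_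
    · convert hp using 3 with i
      exact Finset.sum_erase_add _ _ (Finset.mem_univ k)
    · convert hm using 3 with i
      exact (sum_flipSign (y i) k σ).symm
    · simp only [← mul_sub, abs_mul, abs_boolSign, one_mul]
      exact hk i j
  have hs := Finset.sum_le_sum fun σ (_ : σ ∈ Finset.univ) => key σ
  simp only [Finset.sum_add_distrib, Equiv.sum_comp (flipSign k)] at hs
  linarith

/-- The contraction principle for Rademacher averages. -/
theorem sum_signSup_le_of_contraction [Nonempty ι] {x y : ι → Fin n → ℝ} {C D : ℝ}
    (h : ∀ i j k, |x i k - x j k| ≤ |y i k - y j k|) (hx : ∀ i k, |x i k| ≤ C)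
    (hy : ∀ i k, |y i k| ≤ D) : ∑ σ, signSup x σ ≤ ∑ σ, signSup y σ := by
  have key : ∀ S : Finset (Fin n),
      ∑ σ, signSup (fun i k => if k ∈ S then x i k else y i k) σ ≤ ∑ σ, signSup y σ := by
    intro S
    induction S using Finset.induction_on with
    | empty => simp
    | insert k S hkS ih =>
      refine (sum_signSup_le_of_coord (C := max C D) k ?_ ?_ ?_).trans ih
      · intro i l hl
        simp [hl]
      · intro i j
        simpa [hkS] using h i j k
      · intro i l
        split_ifs
        · exact (hx i l).trans (le_max_left _ _)
        · exact (hy i l).trans (le_max_right _ _)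
  simpa using key Finset.univ

/-- Translating a family of vectors along the diagonal by amounts in `[c - r, c + r]` increases
its Rademacher average by at most `r * √n`. -/
theorem sum_signSup_sub_le {κ : Type*} [Nonempty ι] [Nonempty κ] {x : ι → Fin n → ℝ} {C c r : ℝ}
    {t : κ → ℝ} (hx : ∀ i k, |x i k| ≤ C) (hr : 0 ≤ r) (ht : ∀ j, |t j - c| ≤ r) :
    ∑ σ, signSup (fun (p : ι × κ) k => x p.1 k - t p.2) σ ≤
      ∑ σ, signSup x σ + r * (2 ^ n * √n) := by
  have key : ∀ σ : Fin n → Bool, signSup (fun (p : ι × κ) k => x p.1 k - t p.2) σ ≤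
      signSup x σ - c * ∑ k, boolSign (σ k) + r * |∑ k, boolSign (σ k)| := by
    intro σ
    refine ciSup_le fun p => ?_
    have h1 : ∑ k, boolSign (σ k) * x p.1 k ≤ signSup x σ :=
      le_ciSup (bddAbove_boolSign hx σ) p.1
    simp only [mul_sub, Finset.sum_sub_distrib, ← Finset.sum_mul]
    have h2 : -((t p.2 - c) * ∑ k, boolSign (σ k)) ≤ r * |∑ k, boolSign (σ k)| :=
      (neg_le_abs _).trans (by rw [abs_mul]; gcongr; exact ht p.2)
    linarith
  refine (Finset.sum_le_sum fun σ _ => key σ).trans ?_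
  rw [Finset.sum_add_distrib, Finset.sum_sub_distrib, ← Finset.mul_sum, ← Finset.mul_sum,
    sum_sum_boolSign, mul_zero, sub_zero]
  gcongr
  exact sum_abs_sum_boolSign_le n

theorem sum_signSup_nonneg [Nonempty ι] {x : ι → Fin n → ℝ} {C : ℝ} (hx : ∀ i k, |x i k| ≤ C) :
    0 ≤ ∑ σ, signSup x σ := by
  obtain ⟨i⟩ := ‹Nonempty ι›
  have h : ∑ σ : Fin n → Bool, ∑ k, boolSign (σ k) * x i k = 0 := by
    rw [Finset.sum_comm]
    exact Finset.sum_eq_zero fun k _ => sum_boolSign_mul_eq_zero k (fun _ => x i k) fun _ => rfl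
  rw [← h]
  exact Finset.sum_le_sum fun σ _ => le_ciSup (bddAbove_boolSign hx σ) i

theorem signSup_const_mul {L : ℝ} (hL : 0 ≤ L) (x : ι → Fin n → ℝ) (σ : Fin n → Bool) :
    signSup (fun i k => L * x i k) σ = L * signSup x σ := by
  rw [signSup, signSup, Real.mul_iSup_of_nonneg hL]
  refine iSup_congr fun i => ?_
  rw [Finset.mul_sum]
  exact Finset.sum_congr rfl fun k _ => by ring

end Signs

section Cumulant

variable {f : ℝ → ℝ} {a : ℝ} {b : EReal} {X : Type*} [MeasurableSpace X]

theorem isProbabilityMeasure_empMeas {n : ℕ} (hn : 0 < n) (x : Fin n → X) :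
    IsProbabilityMeasure (empMeas n x) := by
  refine ⟨?_⟩
  simp only [empMeas, Measure.smul_apply, Measure.finsetSum_apply, measure_univ, smul_eq_mul,
    Finset.sum_const, Finset.card_univ, Fintype.card_fin, nsmul_eq_mul, mul_one]
  exact ENNReal.inv_mul_cancel (by simpa using hn.ne') (by simp)

theorem integral_empMeas {n : ℕ} (x : Fin n → X) {h : X → ℝ} (hm : Measurable h) :
    ∫ u, h u ∂(empMeas n x) = (n : ℝ)⁻¹ * ∑ k, h (x k) := by
  rw [empMeas, integral_smul_measure, integral_finsetSum_measure]
  · simp [integral_dirac' _ _ hm.stronglyMeasurable]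
  · intro k _
    exact integrable_dirac' hm.stronglyMeasurable (by simp)

variable (μ : Measure X) {α β ν : ℝ} {h : X → ℝ}

theorem integrable_fStarR_sub [IsProbabilityMeasure μ] (ha0 : 0 ≤ a) (h1 : (1 : ℝ) ∈ Dom a b)
    (hf1 : f 1 = 0) (hz : fStar f a b (β - α + zz f) < ⊤) (hm : Measurable h)
    (hb : ∀ x, h x ∈ Icc α β) (hν : α - zz f ≤ ν) :
    Integrable (fun x => fStarR f a b (h x - ν)) μ :=
  .of_bound ((measurable_fStarR ha0).comp (hm.sub_const ν)).aestronglyMeasurable _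
    (.of_forall (abs_fStarR_sub_le_max ha0 h1 hf1 hz hb hν))

theorem eIntegral_fStar_sub [IsProbabilityMeasure μ] (ha0 : 0 ≤ a) (h1 : (1 : ℝ) ∈ Dom a b)
    (hf1 : f 1 = 0) (hz : fStar f a b (β - α + zz f) < ⊤) (hm : Measurable h)
    (hb : ∀ x, h x ∈ Icc α β) (hν : α - zz f ≤ ν) :
    eIntegral μ (fun x => fStar f a b (h x - ν)) =
      ((∫ x, fStarR f a b (h x - ν) ∂μ : ℝ) : EReal) := by
  rw [eIntegral, if_pos]
  · rfl
  · exact ⟨.of_forall fun x => (fStar_sub_lt_top ha0 hz hb hν x).ne,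
      integrable_fStarR_sub μ ha0 h1 hf1 hz hm hb hν⟩

theorem cgf_le [IsProbabilityMeasure μ] (ha0 : 0 ≤ a) (h1 : (1 : ℝ) ∈ Dom a b)
    (hf1 : f 1 = 0) (hz : fStar f a b (β - α + zz f) < ⊤) (hm : Measurable h)
    (hb : ∀ x, h x ∈ Icc α β) (hν : α - zz f ≤ ν) :
    cgf f a b μ h ≤ ((ν + ∫ x, fStarR f a b (h x - ν) ∂μ : ℝ) : EReal) := by
  refine (iInf_le _ ν).trans_eq ?_
  rw [eIntegral_fStar_sub μ ha0 h1 hf1 hz hm hb hν, EReal.coe_add]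

/-- The infimum defining the cumulant generating function of an `[α, β]`-valued function may be
restricted to the compact interval `[α - z₀, β - z₀]`. -/
theorem le_cgf [IsProbabilityMeasure μ] (ha0 : 0 ≤ a) (h1 : (1 : ℝ) ∈ Dom a b)
    (hf1 : f 1 = 0) (hconv : ConvexOn ℝ (Dom a b) f) (hz : fStar f a b (β - α + zz f) < ⊤)
    (hαβ : α ≤ β) (hm : Measurable h) (hb : ∀ x, h x ∈ Icc α β) {c : ℝ}
    (hc : ∀ ν ∈ Icc (α - zz f) (β - zz f), c ≤ ν + ∫ x, fStarR f a b (h x - ν) ∂μ) :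
    (c : EReal) ≤ cgf f a b μ h := by
  refine le_iInf fun ν => ?_
  rcases le_or_gt (α - zz f) ν with hν | hν
  · rw [eIntegral_fStar_sub μ ha0 h1 hf1 hz hm hb hν]
    norm_cast
    rcases le_or_gt ν (β - zz f) with hν' | hν'
    · exact hc ν ⟨hν, hν'⟩
    · refine (hc (β - zz f) ⟨by linarith, le_rfl⟩).trans ?_
      have hi := integral_mono
        (integrable_fStarR_sub μ ha0 h1 hf1 hz hm hb (show α - zz f ≤ β - zz f by linarith))
        ((integrable_fStarR_sub μ ha0 h1 hf1 hz hm hb hν).add (integrable_const (ν - (β - zz f))))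
        (fun x => by
          have := fStarR_sub_le_sub (f := f) ha0 h1 hf1 hconv
            (show h x - ν ≤ h x - (β - zz f) by linarith) (by linarith [(hb x).2])
          simp only [Pi.add_apply]
          linarith)
      simp only [Pi.add_apply] at hi
      rw [integral_add (integrable_fStarR_sub μ ha0 h1 hf1 hz hm hb hν) (integrable_const _)] at hi
      simp only [integral_const, probReal_univ, one_smul] at hi
      linarith
  · rw [eIntegral]
    split_ifs with hI
    · obtain ⟨hfin, hint⟩ := hI
      norm_cast
      refine (hc (α - zz f) ⟨le_rfl, by linarith⟩).trans ?_
      have hi := integral_mono_ae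
        ((integrable_fStarR_sub μ ha0 h1 hf1 hz hm hb le_rfl).add
          (integrable_const ((α - zz f) - ν))) hint (by
          filter_upwards [hfin] with x hx
          have := sub_le_fStarR_sub (f := f) ha0 h1 hf1 hconv
            (show zz f ≤ h x - (α - zz f) by linarith [(hb x).1])
            (show h x - (α - zz f) ≤ h x - ν by linarith) (lt_top_iff_ne_top.2 hx)
          simp only [fStarR] at this
          simp only [Pi.add_apply, fStarR]
          linarith)
      simp only [Pi.add_apply] at hi
      rw [integral_add (integrable_fStarR_sub μ ha0 h1 hf1 hz hm hb le_rfl)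
        (integrable_const _)] at hi
      simp only [integral_const, probReal_univ, one_smul] at hi
      linarith
    · simp

theorem coe_cgfR [IsProbabilityMeasure μ] (ha0 : 0 ≤ a) (h1 : (1 : ℝ) ∈ Dom a b)
    (hf1 : f 1 = 0) (hconv : ConvexOn ℝ (Dom a b) f) (hz : fStar f a b (β - α + zz f) < ⊤)
    (hαβ : α ≤ β) (hm : Measurable h) (hb : ∀ x, h x ∈ Icc α β) :
    ((cgfR f a b μ h : ℝ) : EReal) = cgf f a b μ h := by
  refine EReal.coe_toReal
    ((cgf_le μ ha0 h1 hf1 hz hm hb le_rfl).trans_lt (EReal.coe_lt_top _)).ne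
    ((EReal.bot_lt_coe α).trans_le (le_cgf μ ha0 h1 hf1 hconv hz hαβ hm hb fun ν hν => ?_)).ne'
  have hi := integral_mono (integrable_const (α - ν))
    (integrable_fStarR_sub μ ha0 h1 hf1 hz hm hb hν.1) (fun x => by
      have := le_fStarR h1 hf1 (fStar_sub_lt_top ha0 hz hb hν.1 x)
      linarith [(hb x).1])
  simp only [integral_const, probReal_univ, one_smul] at hi
  linarith

/-- Two cumulant generating functions differ by at most the difference of the underlying
integrals, uniformly over the optimization interval. -/
theorem cgfR_sub_cgfR_le (μ' : Measure X) [IsProbabilityMeasure μ] [IsProbabilityMeasure μ']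
    (ha0 : 0 ≤ a) (h1 : (1 : ℝ) ∈ Dom a b)
    (hf1 : f 1 = 0) (hconv : ConvexOn ℝ (Dom a b) f) (hz : fStar f a b (β - α + zz f) < ⊤)
    (hαβ : α ≤ β) (hm : Measurable h) (hb : ∀ x, h x ∈ Icc α β) {B : ℝ}
    (hB : ∀ ν ∈ Icc (α - zz f) (β - zz f),
      ∫ x, fStarR f a b (h x - ν) ∂μ - ∫ x, fStarR f a b (h x - ν) ∂μ' ≤ B) :
    cgfR f a b μ h - cgfR f a b μ' h ≤ B := by
  have key : ((cgfR f a b μ h - B : ℝ) : EReal) ≤ cgf f a b μ' h := by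
    refine le_cgf μ' ha0 h1 hf1 hconv hz hαβ hm hb fun ν hν => ?_
    have h2 := cgf_le μ ha0 h1 hf1 hz hm hb hν.1
    rw [← coe_cgfR μ ha0 h1 hf1 hconv hz hαβ hm hb] at h2
    have h3 : cgfR f a b μ h ≤ ν + ∫ x, fStarR f a b (h x - ν) ∂μ := by exact_mod_cast h2
    linarith [hB ν hν]
  rw [← coe_cgfR μ' ha0 h1 hf1 hconv hz hαβ hm hb] at key
  have h3 : cgfR f a b μ h - B ≤ cgfR f a b μ' h := by exact_mod_cast key
  linarith

end Cumulant

section Symmetrization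

variable {ι Y : Type*} [MeasurableSpace Y] {n : ℕ}

theorem measurable_signSup [Countable ι] {Z : Type*} [MeasurableSpace Z]
    {g : ι → Z → Fin n → ℝ} (hg : ∀ i k, Measurable fun z => g i z k) (σ : Fin n → Bool) :
    Measurable fun z => signSup (fun i => g i z) σ :=
  Measurable.iSup fun i => Finset.measurable_sum _ fun k _ => (hg i k).const_mul _

theorem integrable_signSup [Countable ι] [Nonempty ι] {Z : Type*} [MeasurableSpace Z]
    {μ : Measure Z} [IsFiniteMeasure μ] {g : ι → Z → Fin n → ℝ}
    (hg : ∀ i k, Measurable fun z => g i z k) {C : ℝ} (hC : ∀ i z k, |g i z k| ≤ C)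
    (σ : Fin n → Bool) : Integrable (fun z => signSup (fun i => g i z) σ) μ :=
  .of_bound (measurable_signSup hg σ).aestronglyMeasurable (n * C)
    (.of_forall fun z => abs_signSup_le (fun i k => hC i z k) σ)

/-- Exchanging the two entries of those pairs whose sign is negative. -/
def swapPairs (σ : Fin n → Bool) (w : Fin n → Y × Y) (k : Fin n) : Y × Y :=
  if σ k then w k else (w k).swap

theorem measurePreserving_swapPairs (P : Measure Y) [IsProbabilityMeasure P] (σ : Fin n → Bool) :
    MeasurePreserving (swapPairs σ) (Measure.pi fun _ : Fin n => P.prod P)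
      (Measure.pi fun _ : Fin n => P.prod P) := by
  refine measurePreserving_pi _ _ (f := fun k (p : Y × Y) => if σ k then p else p.swap)
    fun k => ?_
  by_cases h : σ k
  · simp only [h, if_true]
    exact MeasurePreserving.id _
  · simpa [h] using Measure.measurePreserving_swap

theorem integral_comp_measurePreserving {Z W : Type*} [MeasurableSpace Z] [MeasurableSpace W]
    {μ : Measure Z} {ν : Measure W} {φ : Z → W} (hφ : MeasurePreserving φ μ ν) {F : W → ℝ}
    (hF : Measurable F) : ∫ z, F (φ z) ∂μ = ∫ w, F w ∂ν := by
  rw [← hφ.map_eq, integral_map hφ.aemeasurable hF.aestronglyMeasurable]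

theorem signSup_sub_le [Nonempty ι] {x y : ι → Fin n → ℝ} {C : ℝ} (hx : ∀ i k, |x i k| ≤ C)
    (hy : ∀ i k, |y i k| ≤ C) (σ : Fin n → Bool) :
    signSup (fun i k => x i k - y i k) σ ≤ signSup x σ + signSup y (fun k => !σ k) := by
  refine ciSup_le fun i => ?_
  have h1 : ∑ k, boolSign (σ k) * x i k ≤ signSup x σ := le_ciSup (bddAbove_boolSign hx σ) i
  have h2 : ∑ k, boolSign (!σ k) * y i k ≤ signSup y fun k => !σ k :=
    le_ciSup (bddAbove_boolSign hy fun k => !σ k) i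
  simp only [boolSign_not, neg_mul, Finset.sum_neg_distrib] at h2
  simp only [mul_sub, Finset.sum_sub_distrib]
  linarith

theorem integral_signSup_pair_eq [Countable ι] (P : Measure Y) [IsProbabilityMeasure P]
    {g : ι → Y → ℝ} (hg : ∀ i, Measurable (g i)) (σ : Fin n → Bool) :
    ∫ p : (Fin n → Y) × (Fin n → Y), signSup (fun i k => g i (p.1 k) - g i (p.2 k))
        (fun _ => true) ∂((Measure.pi fun _ => P).prod (Measure.pi fun _ => P)) =
      ∫ p : (Fin n → Y) × (Fin n → Y), signSup (fun i k => g i (p.1 k) - g i (p.2 k)) σ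
        ∂((Measure.pi fun _ => P).prod (Measure.pi fun _ => P)) := by
  have hDm : ∀ i (k : Fin n), Measurable fun p : (Fin n → Y) × (Fin n → Y) =>
      g i (p.1 k) - g i (p.2 k) := fun i k =>
    ((hg i).comp ((measurable_pi_apply k).comp measurable_fst)).sub
      ((hg i).comp ((measurable_pi_apply k).comp measurable_snd))
  have hmp := measurePreserving_arrowProdEquivProdArrow Y Y (Fin n) (fun _ => P) (fun _ => P)
  have hFm := measurable_signSup hDm
  have e := integral_comp_measurePreserving (measurePreserving_swapPairs P σ)
    ((hFm fun _ => true).comp hmp.measurable)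
  rw [← integral_comp_measurePreserving hmp (hFm _),
    ← integral_comp_measurePreserving hmp (hFm _)]
  refine e.symm.trans (integral_congr_ae (.of_forall fun w => iSup_congr fun i =>
    Finset.sum_congr rfl fun k _ => ?_))
  change boolSign true * (g i (swapPairs σ w k).1 - g i (swapPairs σ w k).2) =
    boolSign (σ k) * (g i (w k).1 - g i (w k).2)
  cases h : σ k <;> simp [swapPairs, h, boolSign]

/-- Symmetrization: the expected one-sided uniform deviation of the empirical sums is at most
twice the (unnormalized) Rademacher average. -/
theorem integral_signSup_sub_le [Countable ι] [Nonempty ι] (P : Measure Y)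
    [IsProbabilityMeasure P] {g : ι → Y → ℝ} (hg : ∀ i, Measurable (g i)) {C : ℝ}
    (hC : ∀ i y, |g i y| ≤ C) :
    ∫ y : Fin n → Y, signSup (fun i k => ∫ u, g i u ∂P - g i (y k)) (fun _ => true)
        ∂(Measure.pi fun _ => P) ≤
      2 * ((2 ^ n)⁻¹ * ∑ σ, ∫ y : Fin n → Y, signSup (fun i k => g i (y k)) σ
        ∂(Measure.pi fun _ => P)) := by
  set Q : Measure (Fin n → Y) := Measure.pi fun _ => P with hQ
  set A : (Fin n → Bool) → ℝ := fun σ => ∫ y, signSup (fun i k => g i (y k)) σ ∂Q with hA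
  set F : (Fin n → Bool) → (Fin n → Y) × (Fin n → Y) → ℝ :=
    fun σ p => signSup (fun i k => g i (p.1 k) - g i (p.2 k)) σ with hF
  have hgk : ∀ i (k : Fin n), Measurable fun y : Fin n → Y => g i (y k) := fun i k =>
    (hg i).comp (measurable_pi_apply k)
  have hint : ∀ i (k : Fin n), Integrable (fun y : Fin n → Y => g i (y k)) Q := fun i k =>
    .of_bound (hgk i k).aestronglyMeasurable C (.of_forall fun y => hC i _)
  have hterm : ∀ i (k : Fin n) v,
      Integrable (fun y : Fin n → Y => boolSign true * (g i (y k) - g i v)) Q := fun i k v =>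
    ((hint i k).sub (integrable_const _)).const_mul (boolSign true)
  have hDC : ∀ (i : ι) (u v : Y), |g i u - g i v| ≤ C + C := fun i u v =>
    (abs_sub _ _).trans (add_le_add (hC i _) (hC i _))
  have hDm : ∀ i (k : Fin n), Measurable fun p : (Fin n → Y) × (Fin n → Y) =>
      g i (p.1 k) - g i (p.2 k) := fun i k =>
    ((hgk i k).comp measurable_fst).sub ((hgk i k).comp measurable_snd)
  have hFm : ∀ σ, Measurable (F σ) := measurable_signSup hDm
  have hFi : ∀ σ, Integrable (F σ) (Q.prod Q) :=
    integrable_signSup hDm fun i p k => hDC i (p.1 k) (p.2 k)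
  have hgP : ∀ i (k : Fin n), ∫ y, g i (y k) ∂Q = ∫ u, g i u ∂P := fun i k =>
    integral_comp_measurePreserving (measurePreserving_eval (fun _ : Fin n => P) k) (hg i)
  have hPC : ∀ i, |∫ u, g i u ∂P| ≤ C := fun i => by
    simpa using norm_integral_le_of_norm_le_const (μ := P) (f := g i) (.of_forall (hC i))
  have hjensen : ∀ y, signSup (fun i k => ∫ u, g i u ∂P - g i (y k)) (fun _ => true) ≤
      ∫ y', F (fun _ => true) (y', y) ∂Q := by
    intro y
    refine ciSup_le fun i => ?_
    have e : ∑ k, boolSign true * (∫ u, g i u ∂P - g i (y k)) =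
        ∫ y', ∑ k, boolSign true * (g i (y' k) - g i (y k)) ∂Q := by
      rw [integral_finsetSum _ fun k _ => hterm i k (y k)]
      refine Finset.sum_congr rfl fun k _ => ?_
      rw [integral_const_mul, integral_sub (hint i k) (integrable_const _), hgP]
      simp
    rw [e]
    refine integral_mono (integrable_finsetSum _ fun k _ => hterm i k (y k))
      (integrable_signSup (fun i k => (hgk i k).sub_const _)
        (fun i y' k => hDC i (y' k) (y k)) _) fun y' => ?_
    exact le_ciSup (bddAbove_boolSign (fun i k => hDC i (y' k) (y k)) fun _ => true) i
  have hfirst : ∫ y, signSup (fun i k => ∫ u, g i u ∂P - g i (y k)) (fun _ => true) ∂Q ≤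
      ∫ p, F (fun _ => true) p ∂(Q.prod Q) := by
    rw [integral_prod_symm _ (hFi _)]
    refine integral_mono (integrable_signSup (fun i k => (hgk i k).const_sub _)
      (C := C + C) (fun i y k => ?_) _) (hFi _).integral_prod_right hjensen
    exact (abs_sub _ _).trans (add_le_add (hPC i) (hC i _))
  have hsymm : ∀ σ, ∫ p, F (fun _ => true) p ∂(Q.prod Q) = ∫ p, F σ p ∂(Q.prod Q) :=
    integral_signSup_pair_eq P hg
  have hsplit : ∀ σ, ∫ p, F σ p ∂(Q.prod Q) ≤ A σ + A fun k => !σ k := by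
    intro σ
    have hm := fun τ => measurable_signSup hgk τ
    have hi := fun τ => integrable_signSup (μ := Q) hgk (fun i y k => hC i (y k)) τ
    have e1 : A σ = ∫ p, signSup (fun i k => g i (p.1 k)) σ ∂(Q.prod Q) :=
      (integral_comp_measurePreserving (measurePreserving_fst (μ := Q) (ν := Q)) (hm σ)).symm
    have e2 : (A fun k => !σ k) =
        ∫ p, signSup (fun i k => g i (p.2 k)) (fun k => !σ k) ∂(Q.prod Q) :=
      (integral_comp_measurePreserving (measurePreserving_snd (μ := Q) (ν := Q)) (hm _)).symm
    rw [e1, e2, ← integral_add ((hi σ).comp_fst Q) ((hi _).comp_snd Q)]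
    exact integral_mono (hFi σ) (((hi σ).comp_fst Q).add ((hi _).comp_snd Q)) fun p =>
      signSup_sub_le (fun i k => hC i (p.1 k)) (fun i k => hC i (p.2 k)) σ
  have hflip : ∑ σ : Fin n → Bool, A (fun k => !σ k) = ∑ σ, A σ :=
    (Function.Involutive.bijective fun σ => by simp).sum_comp A
  have hsum := Finset.sum_le_sum fun σ (_ : σ ∈ Finset.univ) => (hsymm σ).trans_le (hsplit σ)
  rw [Finset.sum_add_distrib, hflip] at hsum
  simp only [Finset.sum_const, Finset.card_univ, Fintype.card_fun, Fintype.card_bool,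
    Fintype.card_fin, nsmul_eq_mul, Nat.cast_pow, Nat.cast_ofNat] at hsum
  refine hfirst.trans ?_
  rw [← mul_assoc, mul_comm (2 : ℝ), mul_assoc, ← div_eq_inv_mul, le_div_iff₀' (by positivity)]
  linarith

end Symmetrization

theorem empRad_eq {Y : Type*} (Ψ : Set (Y → ℝ)) (n : ℕ) (y : Fin n → Y) :
    empRad Ψ n y =
      (2 ^ n)⁻¹ * ((n : ℝ)⁻¹ * ∑ σ, signSup (fun (ψ : Ψ) k => (ψ : Y → ℝ) (y k)) σ) := by
  rw [empRad, Finset.mul_sum Finset.univ _ (n : ℝ)⁻¹]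
  congr 1
  refine Finset.sum_congr rfl fun σ _ => ?_
  rw [signSup, Real.mul_iSup_of_nonneg (by positivity), iSup]
  congr 1
  ext r
  simp only [boolSign, Set.mem_ofPred_eq, Set.mem_range, Subtype.exists, exists_prop]
  exact exists_congr fun ψ => and_congr_right fun _ => eq_comm

theorem empRad_nonneg {Y : Type*} {Ψ : Set (Y → ℝ)} (hΨ : Ψ.Nonempty) {C : ℝ}
    (hC : ∀ ψ ∈ Ψ, ∀ y, |ψ y| ≤ C) (n : ℕ) (y : Fin n → Y) : 0 ≤ empRad Ψ n y := by
  have := hΨ.to_subtype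
  rw [empRad_eq]
  have := sum_signSup_nonneg (x := fun (ψ : Ψ) k => (ψ : Y → ℝ) (y k))
    fun ψ k => hC ψ ψ.2 (y k)
  positivity

theorem integrable_empRad {Y : Type*} [MeasurableSpace Y] {Ψ : Set (Y → ℝ)} (hΨc : Ψ.Countable)
    (hΨ : Ψ.Nonempty) (hΨm : ∀ ψ ∈ Ψ, Measurable ψ) {C : ℝ} (hC : ∀ ψ ∈ Ψ, ∀ y, |ψ y| ≤ C)
    (n : ℕ) (Q : Measure (Fin n → Y)) [IsFiniteMeasure Q] : Integrable (empRad Ψ n) Q := by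
  have := hΨ.to_subtype
  have := hΨc.to_subtype
  have e : empRad Ψ n = fun y =>
      (2 ^ n)⁻¹ * ((n : ℝ)⁻¹ * ∑ σ, signSup (fun (ψ : Ψ) k => (ψ : Y → ℝ) (y k)) σ) :=
    funext (empRad_eq Ψ n)
  rw [e]
  have hint := integrable_signSup (μ := Q) (g := fun (ψ : Ψ) y k => (ψ : Y → ℝ) (y k))
    (fun ψ k => (hΨm ψ ψ.2).comp (measurable_pi_apply k)) fun ψ y k => hC ψ ψ.2 (y k)
  have hsum : Integrable (fun y : Fin n → Y =>
      ∑ σ, signSup (fun (ψ : Ψ) k => (ψ : Y → ℝ) (y k)) σ) Q :=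
    integrable_finsetSum _ fun σ _ => hint σ
  exact (hsum.const_mul _).const_mul _

/-- The rational points of the unit interval. -/
abbrev UnitRat : Type := {q : ℚ // 0 ≤ q ∧ q ≤ 1}

instance : Nonempty UnitRat := ⟨⟨0, le_rfl, zero_le_one⟩⟩

theorem exists_unitRat_near {t : ℝ} (ht : t ∈ Icc (0 : ℝ) 1) {δ : ℝ} (hδ : 0 < δ) :
    ∃ q : UnitRat, |t - q.1| < δ := by
  rcases ht.1.eq_or_lt with h | h
  · exact ⟨⟨0, le_rfl, zero_le_one⟩, by simpa [← h] using hδ⟩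
  · obtain ⟨q, hq1, hq2⟩ := exists_rat_btwn (max_lt h (sub_lt_self t hδ))
    have h0 : (0 : ℝ) ≤ q := (le_max_left _ _).trans hq1.le
    have h1 : (q : ℝ) ≤ 1 := hq2.le.trans ht.2
    refine ⟨⟨q, by exact_mod_cast h0, by exact_mod_cast h1⟩, ?_⟩
    rw [abs_of_nonneg (by simpa using hq2.le)]
    have := (le_max_right _ _).trans_lt hq1
    simp only
    linarith

theorem le_of_unitRat_le {H : ℝ → ℝ} {u v K B : ℝ} (huv : u ≤ v) (hK : 0 ≤ K)
    (hH : ∀ s ∈ Icc u v, ∀ t ∈ Icc u v, |H s - H t| ≤ K * |s - t|)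
    (hB : ∀ q : UnitRat, H (u + q.1 * (v - u)) ≤ B) {x : ℝ} (hx : x ∈ Icc u v) : H x ≤ B := by
  obtain ⟨t, ht, rfl⟩ : ∃ t ∈ Icc (0 : ℝ) 1, x = u + t * (v - u) := by
    rcases huv.eq_or_lt with rfl | h
    · exact ⟨0, by simp, by simpa using hx⟩
    · refine ⟨(x - u) / (v - u), ⟨div_nonneg (by linarith [hx.1]) (by linarith), ?_⟩, ?_⟩
      · rw [div_le_one (by linarith)]
        linarith [hx.2]
      · field_simp [(sub_pos.2 h).ne']
        ring
  refine le_of_forall_pos_le_add fun ε hε => ?_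
  have hd : 0 < K * (v - u) + 1 := by
    have := mul_nonneg hK (sub_nonneg.2 huv)
    linarith
  obtain ⟨q, hq⟩ := exists_unitRat_near ht (div_pos hε hd)
  have hq0 : (0 : ℝ) ≤ q.1 := by exact_mod_cast q.2.1
  have hq1 : (q.1 : ℝ) ≤ 1 := by exact_mod_cast q.2.2
  have hmem : u + q.1 * (v - u) ∈ Icc u v := by
    constructor <;> nlinarith
  have h1 := (le_abs_self _).trans (hH _ hx _ hmem)
  have e : |u + t * (v - u) - (u + q.1 * (v - u))| = |t - q.1| * (v - u) := by
    rw [← abs_of_nonneg (sub_nonneg.2 huv), ← abs_mul, abs_of_nonneg (sub_nonneg.2 huv)]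
    ring_nf
  rw [e] at h1
  have h2 : K * (|t - q.1| * (v - u)) ≤ ε := by
    rw [lt_div_iff₀ hd] at hq
    nlinarith [abs_nonneg (t - (q.1 : ℝ))]
  linarith [hB q]

theorem abs_integral_fStarR_sub_le {X : Type*} [MeasurableSpace X] (μ : Measure X)
    [IsProbabilityMeasure μ] {f : ℝ → ℝ} {a : ℝ} {b : EReal} {α β ν ν' : ℝ} {h : X → ℝ}
    (ha0 : 0 ≤ a) (h1 : (1 : ℝ) ∈ Dom a b) (hf1 : f 1 = 0)
    (hz : β - α + zz f ∈ interior {z : ℝ | fStar f a b z < ⊤}) (hm : Measurable h)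
    (hb : ∀ x, h x ∈ Icc α β) (hν : α - zz f ≤ ν) (hν' : α - zz f ≤ ν') :
    |∫ x, fStarR f a b (h x - ν) ∂μ - ∫ x, fStarR f a b (h x - ν') ∂μ| ≤
      rderiv (fStarR f a b) (β - α + zz f) * |ν - ν'| := by
  have hfin : β - α + zz f ∈ {z : ℝ | fStar f a b z < ⊤} := interior_subset hz
  rw [← integral_sub (integrable_fStarR_sub μ ha0 h1 hf1 hfin hm hb hν)
    (integrable_fStarR_sub μ ha0 h1 hf1 hfin hm hb hν')]
  have key : ∀ x, ‖fStarR f a b (h x - ν) - fStarR f a b (h x - ν')‖ ≤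
      rderiv (fStarR f a b) (β - α + zz f) * |ν - ν'| := fun x => by
    have := abs_fStarR_sub_le ha0 h1 hf1 hz (w := h x - ν) (z := h x - ν')
      (by linarith [(hb x).2]) (by linarith [(hb x).2])
    rwa [sub_sub_sub_cancel_left, abs_sub_comm ν'] at this
  simpa using norm_integral_le_of_norm_le_const (μ := μ) (.of_forall key)

/-- The `Λ`-deviation of each `ψ ∈ Ψ` is controlled by the uniform deviation of the countable
family `s * f*(ψ - ν)`, where `ν` runs over the rational points of the optimization interval. -/
theorem cgfR_deviation_le {Y : Type*} [MeasurableSpace Y] {Ψ : Set (Y → ℝ)}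
    (hΨm : ∀ ψ ∈ Ψ, Measurable ψ) {α β : ℝ} (hαβ : α ≤ β)
    (hbd : ∀ ψ ∈ Ψ, ∀ y, ψ y ∈ Icc α β) {f : ℝ → ℝ} {a : ℝ} {b : EReal} (ha0 : 0 ≤ a)
    (h1 : (1 : ℝ) ∈ Dom a b) (hf1 : f 1 = 0) (hconv : ConvexOn ℝ (Dom a b) f)
    (hz : β - α + zz f ∈ interior {z : ℝ | fStar f a b z < ⊤}) (P : Measure Y)
    [IsProbabilityMeasure P] {n : ℕ} (hn : 0 < n) {s : ℝ} (hs : s = 1 ∨ s = -1)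
    {g : Ψ × UnitRat → Y → ℝ}
    (hg : ∀ i y, g i y =
      s * fStarR f a b ((i.1 : Y → ℝ) y - (α - zz f + i.2.1 * (β - zz f - (α - zz f)))))
    {C : ℝ} (hC : ∀ i y, |g i y| ≤ C) {ψ : Y → ℝ} (hψ : ψ ∈ Ψ) (y : Fin n → Y) :
    s * (cgfR f a b P ψ - cgfR f a b (empMeas n y) ψ) ≤
      (n : ℝ)⁻¹ * signSup (fun i k => ∫ u, g i u ∂P - g i (y k)) (fun _ => true) := by
  have hfin : β - α + zz f ∈ {z : ℝ | fStar f a b z < ⊤} := interior_subset hz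
  have := isProbabilityMeasure_empMeas hn y
  set B := (n : ℝ)⁻¹ * signSup (fun i k => ∫ u, g i u ∂P - g i (y k)) (fun _ => true) with hB
  set L := rderiv (fStarR f a b) (β - α + zz f) with hL
  have hL0 : 0 ≤ L := rderiv_fStarR_nonneg ha0 h1 hf1 hz
  have hs1 : |s| = 1 := by rcases hs with rfl | rfl <;> simp
  have hPC : ∀ i, |∫ u, g i u ∂P| ≤ C := fun i => by
    simpa using norm_integral_le_of_norm_le_const (μ := P) (f := g i) (.of_forall (hC i))
  have key : ∀ ν ∈ Icc (α - zz f) (β - zz f), s * (∫ u, fStarR f a b (ψ u - ν) ∂P -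
      ∫ u, fStarR f a b (ψ u - ν) ∂(empMeas n y)) ≤ B := by
    intro ν hν
    refine le_of_unitRat_le (K := L + L) (H := fun ν => s * (∫ u, fStarR f a b (ψ u - ν) ∂P -
      ∫ u, fStarR f a b (ψ u - ν) ∂(empMeas n y))) (by linarith) (by linarith) ?_ ?_ hν
    · intro c hc d hd
      have e1 := abs_integral_fStarR_sub_le P ha0 h1 hf1 hz (hΨm ψ hψ) (hbd ψ hψ) hc.1 hd.1
      have e2 := abs_integral_fStarR_sub_le (empMeas n y) ha0 h1 hf1 hz (hΨm ψ hψ) (hbd ψ hψ)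
        hc.1 hd.1
      rw [← mul_sub, abs_mul, hs1, one_mul, sub_sub_sub_comm, add_mul]
      exact (abs_sub _ _).trans (add_le_add e1 e2)
    · intro q
      have hb := bddAbove_boolSign (x := fun i k => ∫ u, g i u ∂P - g i (y k)) (C := C + C)
        (fun i k => (abs_sub _ _).trans (add_le_add (hPC i) (hC i _))) fun _ => true
      have hle := le_ciSup hb (⟨ψ, hψ⟩, q)
      have hn' : (n : ℝ) ≠ 0 := by positivity
      have hmq : Measurable fun u =>
          fStarR f a b (ψ u - (α - zz f + q.1 * (β - zz f - (α - zz f)))) :=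
        (measurable_fStarR ha0).comp ((hΨm ψ hψ).sub_const _)
      rw [integral_empMeas y hmq]
      refine le_trans (le_of_eq ?_) (mul_le_mul_of_nonneg_left hle (by positivity))
      simp only [boolSign, if_true, one_mul, Finset.sum_sub_distrib, Finset.sum_const,
        Finset.card_univ, Fintype.card_fin, nsmul_eq_mul, hg, integral_const_mul,
        ← Finset.mul_sum]
      field_simp
  rcases hs with rfl | rfl
  · have := cgfR_sub_cgfR_le P (empMeas n y) ha0 h1 hf1 hconv hfin hαβ (hΨm ψ hψ) (hbd ψ hψ)
      (B := B) fun ν hν => by simpa using key ν hν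
    simpa using this
  · have := cgfR_sub_cgfR_le (empMeas n y) P ha0 h1 hf1 hconv hfin hαβ (hΨm ψ hψ) (hbd ψ hψ)
      (B := B) fun ν hν => by simpa using key ν hν
    simpa using this

/-- Uniform law of large numbers for the generalized cumulant
generating function (first version). -/
theorem stmt6 {Y : Type*} [MeasurableSpace Y]
    (Ψ : Set (Y → ℝ)) (hΨc : Ψ.Countable) (hΨne : Ψ.Nonempty)
    (hΨm : ∀ ψ ∈ Ψ, Measurable ψ) (α β : ℝ) (hbd : ∀ ψ ∈ Ψ, ∀ y, ψ y ∈ Set.Icc α β)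
    (f : ℝ → ℝ) (a : ℝ) (b : EReal)
    (ha0 : 0 ≤ a) (ha1 : a < 1) (hb1 : ((1 : ℝ) : EReal) < b)
    (hconv : ConvexOn ℝ (Dom a b) f) (hf1 : f 1 = 0)
    (hstrict : ∃ ε > 0, Set.Ioo (1 - ε) (1 + ε) ⊆ Dom a b ∧
      StrictConvexOn ℝ (Set.Ioo (1 - ε) (1 + ε)) f)
    (hz : zz f + β - α ∈ interior {z : ℝ | fStar f a b z < ⊤})
    (P : MeasureTheory.Measure Y) [MeasureTheory.IsProbabilityMeasure P]
    (n : ℕ) (hn : 0 < n) (s : ℝ) (hs : s = 1 ∨ s = -1) :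
    (∫ y : Fin n → Y,
        sSup {r : ℝ | ∃ ψ ∈ Ψ, r = s * (cgfR f a b P ψ - cgfR f a b (empMeas n y) ψ)}
        ∂(MeasureTheory.Measure.pi fun _ : Fin n => P)) ≤
      2 * rderiv (fStarR f a b) (β - α + zz f) *
        (rad Ψ P n + (β - α) / (2 * Real.sqrt n)) := by
  have h1 := one_mem_Dom ha1 hb1
  have hz' : β - α + zz f ∈ interior {z : ℝ | fStar f a b z < ⊤} := by
    convert hz using 1; ring
  have hfin : β - α + zz f ∈ {z : ℝ | fStar f a b z < ⊤} := interior_subset hz'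
  obtain ⟨y₀⟩ : Nonempty Y := nonempty_of_isProbabilityMeasure P
  obtain ⟨ψ₀, hψ₀⟩ := hΨne
  have hαβ : α ≤ β := (hbd ψ₀ hψ₀ y₀).1.trans (hbd ψ₀ hψ₀ y₀).2
  have hΨne : Ψ.Nonempty := ⟨ψ₀, hψ₀⟩
  have := hΨne.to_subtype
  have := hΨc.to_subtype
  have hΨC : ∀ ψ ∈ Ψ, ∀ y, |ψ y| ≤ max |β| |α| := fun ψ hψ y => by
    rw [max_comm]
    exact abs_le_max_abs_abs (hbd ψ hψ y).1 (hbd ψ hψ y).2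
  set L := rderiv (fStarR f a b) (β - α + zz f) with hL
  have hL0 : 0 ≤ L := rderiv_fStarR_nonneg ha0 h1 hf1 hz'
  set Q : Measure (Fin n → Y) := Measure.pi fun _ => P with hQ
  have hrad : 0 ≤ rad Ψ P n := integral_nonneg fun y => empRad_nonneg hΨne hΨC n y
  by_cases hint : Integrable (fun y : Fin n → Y => sSup {r : ℝ | ∃ ψ ∈ Ψ,
      r = s * (cgfR f a b P ψ - cgfR f a b (empMeas n y) ψ)}) Q
  swap
  · rw [integral_undef hint]
    have : 0 ≤ (β - α) / (2 * √n) := div_nonneg (by linarith) (by positivity)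
    positivity
  set t : UnitRat → ℝ := fun q => α - zz f + q.1 * (β - zz f - (α - zz f)) with ht
  set g : Ψ × UnitRat → Y → ℝ := fun i y => s * fStarR f a b ((i.1 : Y → ℝ) y - t i.2) with hg
  have hs1 : |s| = 1 := by rcases hs with rfl | rfl <;> simp
  have htmem : ∀ q, t q ∈ Icc (α - zz f) (β - zz f) := fun q => by
    have hq0 : (0 : ℝ) ≤ q.1 := by exact_mod_cast q.2.1
    have hq1 : (q.1 : ℝ) ≤ 1 := by exact_mod_cast q.2.2
    constructor <;> simp only [ht] <;> nlinarith
  have hdiff : ∀ (i : Ψ × UnitRat) y, |(i.1 : Y → ℝ) y - t i.2| ≤ |zz f| + (β - α) := fun i y => by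
    have h2 := hbd i.1 i.1.2 y
    have h3 := htmem i.2
    rw [abs_le]
    constructor <;> linarith [h2.1, h2.2, h3.1, h3.2, le_abs_self (zz f), neg_abs_le (zz f)]
  set C := max |fStarR f a b (β - α + zz f)| (|zz f| + (β - α)) with hCdef
  have hgC : ∀ i y, |g i y| ≤ C := fun i y => by
    rw [hg, abs_mul, hs1, one_mul]
    refine (abs_fStarR_sub_le_max ha0 h1 hf1 hfin (hbd i.1 i.1.2) (htmem i.2).1 y).trans
      (max_le_max le_rfl ?_)
    have h3 := htmem i.2
    rw [abs_le]
    constructor <;> linarith [h3.1, h3.2, le_abs_self (zz f), neg_abs_le (zz f)]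
  have hgm : ∀ i, Measurable (g i) := fun i =>
    ((measurable_fStarR ha0).comp ((hΨm i.1 i.1.2).sub_const _)).const_mul s
  have hPC : ∀ i, |∫ u, g i u ∂P| ≤ C := fun i => by
    simpa using norm_integral_le_of_norm_le_const (μ := P) (f := g i) (.of_forall (hgC i))
  have hgk : ∀ i (k : Fin n), Measurable fun y : Fin n → Y => g i (y k) := fun i k =>
    (hgm i).comp (measurable_pi_apply k)
  have hdev : ∀ y : Fin n → Y,
      sSup {r : ℝ | ∃ ψ ∈ Ψ, r = s * (cgfR f a b P ψ - cgfR f a b (empMeas n y) ψ)} ≤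
        (n : ℝ)⁻¹ * signSup (fun i k => ∫ u, g i u ∂P - g i (y k)) (fun _ => true) := fun y => by
    refine csSup_le ⟨_, ψ₀, hψ₀, rfl⟩ ?_
    rintro _ ⟨ψ, hψ, rfl⟩
    exact cgfR_deviation_le hΨm hαβ hbd ha0 h1 hf1 hconv hz' P hn hs (fun _ _ => rfl) hgC hψ y
  have hcontr : ∀ y : Fin n → Y, ∑ σ, signSup (fun i k => g i (y k)) σ ≤
      L * (2 ^ n * (n * empRad Ψ n y) + (β - α) / 2 * (2 ^ n * √n)) := fun y => by
    have e1 := sum_signSup_le_of_contraction (x := fun i k => g i (y k))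
      (y := fun (i : Ψ × UnitRat) k => L * ((i.1 : Y → ℝ) (y k) - t i.2)) (C := C)
      (D := L * (|zz f| + (β - α))) (fun i j k => by
        rw [← mul_sub, ← mul_sub, abs_mul, abs_mul, hs1, one_mul, abs_of_nonneg hL0]
        have hi := hbd i.1 i.1.2 (y k)
        have hj := hbd j.1 j.1.2 (y k)
        exact abs_fStarR_sub_le ha0 h1 hf1 hz' (by linarith [hi.2, (htmem i.2).1])
          (by linarith [hj.2, (htmem j.2).1]))
      (fun i k => hgC i (y k)) fun i k => by
        rw [abs_mul, abs_of_nonneg hL0]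
        exact mul_le_mul_of_nonneg_left (hdiff i (y k)) hL0
    have e2 := sum_signSup_sub_le (x := fun (ψ : Ψ) k => (ψ : Y → ℝ) (y k)) (t := t)
      (c := α - zz f + (β - α) / 2) (r := (β - α) / 2) (fun ψ k => hΨC ψ ψ.2 (y k))
      (by linarith) fun q => by
        rw [abs_le]
        constructor <;> linarith [(htmem q).1, (htmem q).2]
    have e3 : ∑ σ, signSup (fun (ψ : Ψ) k => (ψ : Y → ℝ) (y k)) σ =
        2 ^ n * (n * empRad Ψ n y) := by
      have hn' : (n : ℝ) ≠ 0 := by positivity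
      rw [empRad_eq]
      field_simp
    simp only [signSup_const_mul hL0, ← Finset.mul_sum] at e1
    rw [e3] at e2
    exact e1.trans (mul_le_mul_of_nonneg_left e2 hL0)
  have hempint : Integrable (empRad Ψ n) Q := integrable_empRad hΨc hΨne hΨm hΨC n Q
  have hgint := integrable_signSup (μ := Q) hgk fun i y k => hgC i (y k)
  have hA : ∑ σ, ∫ y, signSup (fun i k => g i (y k)) σ ∂Q ≤
      L * (2 ^ n * (n * rad Ψ P n) + (β - α) / 2 * (2 ^ n * √n)) := by
    rw [← integral_finsetSum _ fun σ _ => hgint σ]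
    have hbase := ((hempint.const_mul (n : ℝ)).const_mul (2 ^ n : ℝ))
    refine (integral_mono (integrable_finsetSum _ fun σ _ => hgint σ)
      ((hbase.add (integrable_const ((β - α) / 2 * (2 ^ n * √n)))).const_mul L)
      hcontr).trans_eq ?_
    rw [integral_const_mul, integral_add' hbase (integrable_const _), integral_const_mul,
      integral_const_mul]
    simp [rad, hQ]
  have hDint : Integrable (fun y : Fin n → Y =>
      signSup (fun i k => ∫ u, g i u ∂P - g i (y k)) (fun _ => true)) Q :=
    integrable_signSup (fun i k => (hgk i k).const_sub _) (C := C + C)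
      (fun i y k => (abs_sub _ _).trans (add_le_add (hPC i) (hgC i _))) _
  calc
    _ ≤ ∫ y, (n : ℝ)⁻¹ * signSup (fun i k => ∫ u, g i u ∂P - g i (y k)) (fun _ => true) ∂Q :=
      integral_mono hint (hDint.const_mul _) hdev
    _ ≤ (n : ℝ)⁻¹ * (2 * ((2 ^ n)⁻¹ *
        (L * (2 ^ n * (n * rad Ψ P n) + (β - α) / 2 * (2 ^ n * √n))))) := by
      rw [integral_const_mul]
      have := integral_signSup_sub_le (n := n) P hgm hgC
      gcongr
      refine this.trans ?_
      gcongr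
    _ = 2 * L * (rad Ψ P n + (β - α) / (2 * √n)) := by
      have hn' : (n : ℝ) ≠ 0 := by positivity
      have hsn : √(n : ℝ) ^ 2 = n := Real.sq_sqrt (by positivity)
      field_simp
      linear_combination (L * (β - α)) * hsn
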